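/- arXiv:gr-qc/0301073 — 3 statements merged into one kernel-verified Lean document; each statement's English description precedes it below -/
import Mathlib

section
/- Let U and V be open subsets of ℝⁿ, let G : U → V be a homeomorphism, and let (G_λ)_{λ∈ℝ} be a family of continuous functions from U to ℝⁿ such that sup_{x∈U} ‖G_λ(x) − G(x)‖ → 0 as λ → ∞. Then for every y ∈ V there exists Λ ∈ ℝ such that for all λ ≥ Λ there exists x_λ ∈ U with G_λ(x_λ) = y. -/
open MeasureTheory Metric Set Polynomial
open scoped NNReal Topology ContDiff Manifold

section Determinant

/-- `t ↦ det (1 + t A)` is a polynomial of degree at most the dimension. -/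
lemma exists_polynomial_eval_eq_det_one_add_smul {K M : Type*} [Field K] [AddCommGroup M]
    [Module K M] [FiniteDimensional K M] (A : M →ₗ[K] M) :
    ∃ p : K[X], p.natDegree ≤ Module.finrank K M ∧
      ∀ t : K, p.eval t = LinearMap.det (1 + t • A) := by
  let b := Module.finBasis K M
  refine ⟨_, (natDegree_det_X_add_C_le (LinearMap.toMatrix b b A) 1).trans_eq (by simp), ?_⟩
  intro t
  rw [← coe_evalRingHom, RingHom.map_det, ← LinearMap.det_toMatrix b]
  congr 1
  ext i j
  simp [LinearMap.toMatrix_one, Matrix.one_apply, add_comm, apply_ite (eval t), mul_comm t]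

/-- Lagrange interpolation of `t ↦ det (1 + t A)`, with weights independent of `A`. -/
lemma det_one_add_eq_sum_basis_mul {K M : Type*} [Field K] [AddCommGroup M]
    [Module K M] [FiniteDimensional K M] [DecidableEq K] {s : Finset K}
    (hs : Module.finrank K M < s.card) (A : M →ₗ[K] M) :
    LinearMap.det (1 + A) =
      ∑ i ∈ s, (Lagrange.basis s id i).eval 1 * LinearMap.det (1 + i • A) := by
  obtain ⟨p, hp, hpe⟩ := exists_polynomial_eval_eq_det_one_add_smul A
  have hdeg : p.degree < s.card :=
    degree_le_natDegree.trans_lt (by exact_mod_cast hp.trans_lt hs)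
  have h := congrArg (eval 1)
    (Lagrange.eq_interpolate (v := id) (Function.injective_id.injOn) hdeg)
  rw [hpe, one_smul, Lagrange.interpolate_apply, eval_finsetSum] at h
  rw [h]
  refine Finset.sum_congr rfl fun i _ => ?_
  rw [eval_mul, eval_C, mul_comm, id, hpe]

lemma det_one_add_smul_pos {E : Type*} [NormedAddCommGroup E] [NormedSpace ℝ E]
    [FiniteDimensional ℝ E] {A : E →L[ℝ] E} {K t : ℝ} (hA : ‖A‖ ≤ K) (ht : 0 ≤ t)
    (htK : t * K < 1) : 0 < (1 + t • A).det := by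
  have hne : ∀ s ∈ Icc 0 t, (1 + s • A).det ≠ 0 := by
    intro s hs h0
    obtain ⟨v, hv, hv0⟩ := (Submodule.ne_bot_iff _).1
      (LinearMap.bot_lt_ker_of_det_eq_zero (f := ((1 + s • A : E →L[ℝ] E) : E →ₗ[ℝ] E)) h0).ne'
    have hv' : v = -(s • A v) := by
      have : v + s • A v = 0 := by simpa using hv
      exact eq_neg_of_add_eq_zero_left this
    have h1 : ‖v‖ ≤ t * K * ‖v‖ := by
      calc ‖v‖ = s * ‖A v‖ := by
            conv_lhs => rw [hv', norm_neg, norm_smul, Real.norm_of_nonneg hs.1]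
        _ ≤ t * (K * ‖v‖) := by
            gcongr
            · exact hs.2
            · exact (A.le_opNorm v).trans (by gcongr)
        _ = _ := by ring
    have : 0 < ‖v‖ := norm_pos_iff.2 hv0
    nlinarith
  have hc : Continuous fun s : ℝ => (1 + s • A).det :=
    ContinuousLinearMap.continuous_det.comp (by fun_prop)
  have h0 : (1 + (0 : ℝ) • A).det = 1 := by
    simp [ContinuousLinearMap.det]
  by_contra! hle
  obtain ⟨s, hs, hs0⟩ := intermediate_value_Icc' ht hc.continuousOn
    (show (0 : ℝ) ∈ Icc _ _ from ⟨hle, h0 ▸ zero_le_one⟩)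
  exact hne s hs hs0

end Determinant

section Lipschitz

variable {E F : Type*} [NormedAddCommGroup E] [NormedSpace ℝ E] [NormedAddCommGroup F]

/-- Extension by zero of a Lipschitz map on a closed ball vanishing on the sphere. -/
lemma LipschitzOnWith.indicator_closedBall {f : E → F} {K : ℝ≥0} {r : ℝ}
    (hf : LipschitzOnWith K f (closedBall 0 r)) (h0 : ∀ x, ‖x‖ = r → f x = 0) :
    LipschitzWith K ((closedBall 0 r).indicator f) := by
  have key : ∀ x ∈ closedBall (0 : E) r, ∀ y ∉ closedBall (0 : E) r,
      dist (f x) 0 ≤ K * dist x y := by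
    intro x hx y hy
    simp only [mem_closedBall_zero_iff, not_le] at hx hy
    have hc : Continuous fun s : ℝ => ‖AffineMap.lineMap (k := ℝ) x y s‖ :=
      AffineMap.lineMap_continuous.norm
    obtain ⟨s, hs, hsr⟩ := intermediate_value_Icc zero_le_one hc.continuousOn
      (show r ∈ Icc _ _ from ⟨by simpa using hx, by simpa using hy.le⟩)
    dsimp only at hsr
    rw [← h0 _ hsr]
    refine (hf.dist_le_mul _ (by simpa using hx) _ (by simp [hsr])).trans ?_
    gcongr
    rw [dist_left_lineMap, Real.norm_of_nonneg hs.1]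
    exact mul_le_of_le_one_left dist_nonneg hs.2
  refine LipschitzWith.of_dist_le_mul fun x y => ?_
  by_cases hx : x ∈ closedBall (0 : E) r <;> by_cases hy : y ∈ closedBall (0 : E) r
  · simpa [hx, hy] using hf.dist_le_mul x hx y hy
  · simpa only [indicator_of_mem hx, indicator_of_notMem hy] using key x hx y hy
  · simpa only [indicator_of_mem hy, indicator_of_notMem hx, dist_comm] using key y hy x hx
  · simp only [indicator_of_notMem hx, indicator_of_notMem hy, dist_self]
    positivity

lemma LipschitzWith.bijective_id_add_smul [CompleteSpace E] {h : E → E} {K : ℝ≥0}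
    (hh : LipschitzWith K h) {t : ℝ} (ht : 0 ≤ t) (htK : t * K < 1) :
    Function.Bijective fun x => x + t • h x := by
  lift t to ℝ≥0 using ht
  have ha : ApproximatesLinearOn (fun x => x + (t : ℝ) • h x)
      ((ContinuousLinearEquiv.refl ℝ E : E ≃L[ℝ] E) : E →L[ℝ] E) univ (t * K) := by
    rw [ApproximatesLinearOn.approximatesLinearOn_iff_lipschitzOnWith]
    refine LipschitzWith.lipschitzOnWith (LipschitzWith.of_dist_le_mul fun x y => ?_)
    have := hh.dist_le_mul x y
    simp only [dist_eq_norm] at this ⊢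
    simp only [Pi.sub_apply, ContinuousLinearEquiv.coe_coe, ContinuousLinearEquiv.refl_apply,
      add_sub_cancel_left, ← smul_sub, norm_smul, NNReal.norm_eq, NNReal.coe_mul]
    rw [mul_assoc]
    gcongr
  refine (ha.toHomeomorph _ ?_).bijective
  rcases subsingleton_or_nontrivial E with hE | hE
  · exact Or.inl hE
  · right
    have : ‖((ContinuousLinearEquiv.refl ℝ E).symm : E →L[ℝ] E)‖₊ = 1 :=
      NNReal.eq ContinuousLinearMap.norm_id
    rw [this, inv_one]
    exact_mod_cast htK

end Lipschitz

section Brouwer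

variable {E : Type*} [NormedAddCommGroup E] [InnerProductSpace ℝ E] [FiniteDimensional ℝ E]

lemma det_fderiv_eq_zero_of_norm_eq {R : E → E} {r : ℝ} (hr : 0 < r) {x : E}
    (hR : DifferentiableAt ℝ R x) (hn : ∀ y, ‖R y‖ = r) : (fderiv ℝ R x).det = 0 := by
  by_contra hdet
  obtain ⟨v, hv⟩ := (LinearMap.equivOfDetNeZero
    ((fderiv ℝ R x : E →L[ℝ] E) : E →ₗ[ℝ] E) hdet).surjective (R x)
  replace hv : fderiv ℝ R x v = R x := hv
  have h1 := hR.hasFDerivAt.norm_sq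
  have h2 : (fun y => ‖R y‖ ^ 2) = fun _ => r ^ 2 := by
    ext y
    rw [hn]
  rw [h2] at h1
  have h3 := congrArg (fun L : E →L[ℝ] ℝ => L v) (h1.unique (hasFDerivAt_const _ _))
  simp [hv, hn] at h3
  exact hr.ne' h3

/-- There is no `C¹` retraction of a ball onto its boundary sphere. -/
theorem not_exists_contDiff_retraction_sphere {r : ℝ} (hr : 0 < r) :
    ¬ ∃ R : E → E, ContDiff ℝ 1 R ∧ (∀ x, ‖x‖ = r → R x = x) ∧ ∀ x, ‖R x‖ = r := by
  classical
  rintro ⟨R, hR, hid, hn⟩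
  let _ : MeasurableSpace E := borel E
  have : BorelSpace E := ⟨rfl⟩
  let μ : Measure E := volume
  have hdiff : ContDiff ℝ 1 fun x => R x - x := hR.sub contDiff_id
  obtain ⟨K, hK⟩ := hdiff.contDiffOn.exists_lipschitzOnWith one_ne_zero
    (convex_closedBall (0 : E) r) (isCompact_closedBall 0 r)
  set h : E → E := (closedBall 0 r).indicator fun x => R x - x with hh
  have hL : LipschitzWith K h :=
    hK.indicator_closedBall fun x hx => by rw [hid x hx, sub_self]
  set A : E → E →L[ℝ] E := fun x => fderiv ℝ R x - 1 with hA
  have hder : ∀ x ∈ ball (0 : E) r, HasFDerivAt h (A x) x := by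
    intro x hx
    refine (((hR.differentiable one_ne_zero x).hasFDerivAt).sub
      (hasFDerivAt_id x)).congr_of_eventuallyEq ?_
    filter_upwards [isOpen_ball.mem_nhds hx] with y hy
    exact indicator_of_mem (ball_subset_closedBall hy) _
  have hout : ∀ x ∉ ball (0 : E) r, h x = 0 := by
    intro x hx
    by_cases hx' : x ∈ closedBall (0 : E) r
    · have : ‖x‖ = r := le_antisymm (by simpa using hx') (by simpa using hx)
      rw [hh, indicator_of_mem hx', hid x this, sub_self]
    · exact indicator_of_notMem hx' _
  have hvol : ∀ t : ℝ, 0 ≤ t → t * K < 1 →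
      IntegrableOn (fun x => (1 + t • A x).det) (ball 0 r) μ ∧
      ∫ x in ball 0 r, (1 + t • A x).det ∂μ = μ.real (ball 0 r) := by
    intro t ht htK
    have hbij := hL.bijective_id_add_smul ht htK
    have himg : (fun x => x + t • h x) '' ball 0 r = ball 0 r := by
      rw [← compl_inj_iff, ← image_compl_eq hbij]
      exact (image_congr fun x hx => by rw [hout x hx, smul_zero, add_zero]).trans (image_id' _)
    have hd : ∀ x ∈ ball (0 : E) r,
        HasFDerivWithinAt (fun x => x + t • h x) (1 + t • A x) (ball 0 r) x := fun x hx =>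
      ((hasFDerivAt_id x).add ((hder x hx).const_smul t)).hasFDerivWithinAt
    have hpos : ∀ x ∈ ball (0 : E) r,
        |(1 + t • A x).det| • (1 : ℝ) = (1 + t • A x).det := by
      intro x hx
      have hAK : ‖A x‖ ≤ K := (hder x hx).fderiv ▸ norm_fderiv_le_of_lipschitz ℝ hL
      rw [abs_of_pos (det_one_add_smul_pos hAK ht htK), smul_eq_mul, mul_one]
    constructor
    · have := (integrableOn_image_iff_integrableOn_abs_det_fderiv_smul μ measurableSet_ball hd
        hbij.injective.injOn fun _ => (1 : ℝ)).1
          (by rw [himg]; exact integrableOn_const measure_ball_lt_top.ne)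
      exact this.congr_fun hpos measurableSet_ball
    · have := integral_image_eq_integral_abs_det_fderiv_smul μ measurableSet_ball hd
        hbij.injective.injOn fun _ => (1 : ℝ)
      rw [himg, setIntegral_congr_fun measurableSet_ball hpos] at this
      rw [← this]
      simp
  obtain ⟨s, hsub, hcard⟩ :=
    (Ioo_infinite (inv_pos.2 (by positivity : (0 : ℝ) < K + 1))).exists_subset_card_eq
      (Module.finrank ℝ E + 1)
  have hs : ∀ i ∈ s, 0 ≤ i ∧ i * K < 1 := by
    intro i hi
    obtain ⟨h0, h1⟩ := hsub hi
    refine ⟨h0.le, ?_⟩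
    rw [lt_inv_comm₀ h0 (by positivity), ← one_div, lt_div_iff₀ h0] at h1
    nlinarith
  have hzero : ∀ x, ∑ i ∈ s, (Lagrange.basis s id i).eval 1 * (1 + i • A x).det = 0 := by
    intro x
    have h1 := det_one_add_eq_sum_basis_mul (hcard ▸ Nat.lt_succ_self _ :
      Module.finrank ℝ E < s.card) ((A x : E →L[ℝ] E) : E →ₗ[ℝ] E)
    have h2 := det_fderiv_eq_zero_of_norm_eq hr (hR.differentiable one_ne_zero x) hn
    have h3 : fderiv ℝ R x = 1 + A x := by simp [hA]
    rw [h3] at h2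
    exact h1.symm.trans h2
  have hsum : ∑ i ∈ s, (Lagrange.basis s id i).eval (1 : ℝ) = 1 := by
    rw [← eval_finsetSum, Lagrange.sum_basis Function.injective_id.injOn
      (Finset.card_pos.1 (by omega)), eval_one]
  have hint : ∫ x in ball 0 r,
      ∑ i ∈ s, (Lagrange.basis s id i).eval 1 * (1 + i • A x).det ∂μ = μ.real (ball 0 r) := by
    rw [integral_finsetSum _ fun i hi => (hvol i (hs i hi).1 (hs i hi).2).1.const_mul _]
    rw [← one_mul (μ.real (ball 0 r)), ← congrArg (· * μ.real (ball 0 r)) hsum, Finset.sum_mul]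
    refine Finset.sum_congr rfl fun i hi => ?_
    rw [integral_const_mul, (hvol i (hs i hi).1 (hs i hi).2).2]
  simp only [hzero, integral_zero] at hint
  exact (ENNReal.toReal_pos (measure_ball_pos μ 0 hr).ne' measure_ball_lt_top.ne).ne hint

/-- A nonvanishing continuous perturbation of the identity can be smoothed, keeping it nonvanishing,
to one that is the identity on the boundary sphere. -/
lemma exists_contDiff_nonvanishing {r : ℝ} (hr : 0 < r) {h : E → E}
    (hc : ContinuousOn h (ball 0 r)) (hb : ∀ x ∈ ball 0 r, ‖h x‖ < r / 2)
    (hne : ∀ x ∈ ball 0 r, x + h x ≠ 0) :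
    ∃ q : E → E, ContDiff ℝ 1 q ∧ (∀ x, ‖x‖ = r → q x = x) ∧ ∀ x, q x ≠ 0 := by
  have hsub : closedBall (0 : E) (r / 2) ⊆ ball 0 r := closedBall_subset_ball (by linarith)
  obtain ⟨x₀, hx₀, hmin⟩ := (isCompact_closedBall (0 : E) (r / 2)).exists_isMinOn
    ⟨0, mem_closedBall_self (half_pos hr).le⟩
    ((continuous_id.continuousOn.add (hc.mono hsub)).norm)
  set δ := ‖x₀ + h x₀‖
  have hδ : 0 < δ := norm_pos_iff.2 (hne x₀ (hsub hx₀))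
  let t : E → Set E := fun x =>
    {v | (‖x‖ = r → v = 0) ∧ ‖v‖ < r / 2 ∧ (‖x‖ ≤ r / 2 → ‖v - h x‖ < δ)}
  have hconv : ∀ x, Convex ℝ (t x) := by
    intro x
    have h1 : Convex ℝ {v : E | ‖x‖ = r → v = 0} := by
      by_cases hx : ‖x‖ = r
      · simp [hx]
      · simpa [hx] using convex_univ
    have h2 : Convex ℝ {v : E | ‖v‖ < r / 2} := by
      simpa [ball, dist_zero_right] using convex_ball (0 : E) (r / 2)
    have h3 : Convex ℝ {v : E | ‖x‖ ≤ r / 2 → ‖v - h x‖ < δ} := by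
      by_cases hx : ‖x‖ ≤ r / 2
      · simpa [hx, ball, dist_eq_norm] using convex_ball (h x) δ
      · simpa [hx] using convex_univ
    exact h1.inter (h2.inter h3)
  obtain ⟨g, hg⟩ := exists_contMDiffMap_forall_mem_convex_of_local_const (n := 1) 𝓘(ℝ, E)
    hconv fun x => by
      by_cases hx : ‖x‖ ≤ r / 2
      · have hxr : x ∈ ball (0 : E) r := hsub (by simpa using hx)
        refine ⟨h x, ?_⟩
        have hcx : ContinuousAt h x := hc.continuousAt (isOpen_ball.mem_nhds hxr)
        filter_upwards [isOpen_ball.mem_nhds hxr, hcx (ball_mem_nhds _ hδ)] with y hy hyx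
        refine ⟨fun hyr => absurd hyr (by simpa using hy : ‖y‖ < r).ne, hb x hxr, fun _ => ?_⟩
        rwa [← dist_eq_norm, dist_comm]
      · refine ⟨0, ?_⟩
        filter_upwards [continuous_norm.continuousAt.eventually_const_lt (not_le.1 hx)] with y hy
        exact ⟨fun _ => rfl, by simpa using hr, fun hy' => absurd hy' hy.not_ge⟩
  refine ⟨fun x => x + g x, contDiff_id.add g.contMDiff.contDiff, fun x hx => ?_, fun x hx => ?_⟩
  · simp [(hg x).1 hx]
  · obtain ⟨-, h2, h3⟩ := hg x
    have hxg : x = -g x := eq_neg_of_add_eq_zero_left hx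
    have hxn : ‖x‖ ≤ r / 2 := by
      rw [hxg, norm_neg]
      exact h2.le
    have h4 : δ ≤ ‖x + h x‖ := hmin (by simpa using hxn)
    have h5 := h3 hxn
    have h6 : g x - h x = -(x + h x) := by
      rw [eq_neg_of_add_eq_zero_right hx]
      abel
    rw [h6, norm_neg] at h5
    exact h4.not_gt h5

/-- A continuous map on a ball that is uniformly close to the identity vanishes somewhere. -/
theorem exists_add_eq_zero_of_norm_lt {r : ℝ} (hr : 0 < r) {h : E → E}
    (hc : ContinuousOn h (ball 0 r)) (hb : ∀ x ∈ ball 0 r, ‖h x‖ < r / 2) :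
    ∃ x ∈ ball 0 r, x + h x = 0 := by
  by_contra! hne
  obtain ⟨q, hq, hid, hq0⟩ := exists_contDiff_nonvanishing hr hc hb hne
  refine not_exists_contDiff_retraction_sphere hr
    ⟨fun x => (r / ‖q x‖) • q x, ?_, fun x hx => ?_, fun x => ?_⟩
  · exact (contDiff_const.div (hq.norm ℝ hq0) fun x => norm_ne_zero_iff.2 (hq0 x)).smul hq
  · simp only [hid x hx, hx, div_self hr.ne', one_smul]
  · rw [norm_smul, norm_div, norm_norm, Real.norm_of_nonneg hr.le,
      div_mul_cancel₀ _ (norm_ne_zero_iff.2 (hq0 x))]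

end Brouwer

/-- If a family of continuous maps `G_λ : U → ℝⁿ` converges uniformly to a
homeomorphism `G : U → V`, then any `y ∈ V` is attained by `G_λ` for all
sufficiently large `λ`. -/
theorem eventually_surjective_of_uniform_limit_homeomorph
    (n : ℕ) (U V : Set (EuclideanSpace ℝ (Fin n)))
    (hU : IsOpen U) (hV : IsOpen V) (G : U ≃ₜ V)
    (Gfam : ℝ → U → EuclideanSpace ℝ (Fin n))
    (hGfam : ∀ lam : ℝ, Continuous (Gfam lam))
    (hconv : ∀ ε > 0, ∃ Λ : ℝ, ∀ lam ≥ Λ, ∀ x : U,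
      ‖Gfam lam x - (G x : EuclideanSpace ℝ (Fin n))‖ < ε) :
    ∀ y ∈ V, ∃ Λ : ℝ, ∀ lam ≥ Λ, ∃ x : U, Gfam lam x = y := by
  intro y hy
  obtain ⟨r, hr, hrV⟩ := Metric.isOpen_iff.1 hV y hy
  obtain ⟨Λ, hΛ⟩ := hconv (r / 2) (by positivity)
  refine ⟨Λ, fun lam hlam => ?_⟩
  have hmem : ∀ z ∈ ball (0 : EuclideanSpace ℝ (Fin n)) r, y + z ∈ V := fun z hz =>
    hrV (by simpa using hz)
  classical
  let h : EuclideanSpace ℝ (Fin n) → EuclideanSpace ℝ (Fin n) := fun z =>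
    if hz : y + z ∈ V then Gfam lam (G.symm ⟨y + z, hz⟩) - (y + z) else 0
  have hc : ContinuousOn h (ball 0 r) := by
    rw [continuousOn_iff_continuous_domRestrict]
    have : (ball 0 r).domRestrict h = fun z : ball (0 : EuclideanSpace ℝ (Fin n)) r =>
        Gfam lam (G.symm ⟨y + z, hmem z z.2⟩) - (y + z) :=
      funext fun z => dif_pos (hmem z z.2)
    rw [this]
    exact ((hGfam lam).comp (G.symm.continuous.comp (by fun_prop))).sub (by fun_prop)
  have hb : ∀ z ∈ ball 0 r, ‖h z‖ < r / 2 := by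
    intro z hz
    have := hΛ lam hlam (G.symm ⟨y + z, hmem z hz⟩)
    rw [G.apply_symm_apply] at this
    simpa only [h, dif_pos (hmem z hz)] using this
  obtain ⟨z, hz, hz0⟩ := exists_add_eq_zero_of_norm_lt hr hc hb
  refine ⟨G.symm ⟨y + z, hmem z hz⟩, ?_⟩
  simp only [h, dif_pos (hmem z hz)] at hz0
  rw [← sub_eq_zero, ← hz0]
  abel
end

section
/- Let n ≥ 2 and let s ∈ ℝ with s ≠ 0 and s ≠ 1. Then there exists a constant C > 0 such that for every C¹ vector field Y on ℝⁿ with compact support contained in ℝⁿ ∖ {0}, one has ∫ r^{−2s−n+2} |S(Y)|² dx ≥ C ∫ r^{−2s−n} |Y|² dx, where r = ‖x‖. -/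
open MeasureTheory Real

/-- The `i`-th partial derivative of a function on `ℝⁿ`. -/
noncomputable def pd (n : ℕ) (f : EuclideanSpace ℝ (Fin n) → ℝ)
    (i : Fin n) (x : EuclideanSpace ℝ (Fin n)) : ℝ :=
  fderiv ℝ f x (EuclideanSpace.single i 1)

/-- The squared Euclidean norm of the gradient, `|∇f|² = Σᵢ (∂ᵢf)²`. -/
noncomputable def gradSq (n : ℕ) (f : EuclideanSpace ℝ (Fin n) → ℝ)
    (x : EuclideanSpace ℝ (Fin n)) : ℝ :=
  ∑ i, (pd n f i x) ^ 2

/-- The Euclidean Laplacian, `Δf = Σᵢ ∂ᵢ²f`. -/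
noncomputable def lap (n : ℕ) (f : EuclideanSpace ℝ (Fin n) → ℝ)
    (x : EuclideanSpace ℝ (Fin n)) : ℝ :=
  ∑ i, pd n (pd n f i) i x

/-- The partial derivative `∂ᵢYⱼ` of a vector field `Y` on `ℝⁿ`. -/
noncomputable def vpd (n : ℕ)
    (Y : EuclideanSpace ℝ (Fin n) → EuclideanSpace ℝ (Fin n))
    (i j : Fin n) (x : EuclideanSpace ℝ (Fin n)) : ℝ :=
  fderiv ℝ (fun y => Y y j) x (EuclideanSpace.single i 1)

/-- The symmetrized gradient `S(Y)ᵢⱼ = (∂ᵢYⱼ + ∂ⱼYᵢ)/2` of a vector field. -/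
noncomputable def symGrad (n : ℕ)
    (Y : EuclideanSpace ℝ (Fin n) → EuclideanSpace ℝ (Fin n))
    (i j : Fin n) (x : EuclideanSpace ℝ (Fin n)) : ℝ :=
  (vpd n Y i j x + vpd n Y j i x) / 2

/-- The divergence `div Y = Σᵢ ∂ᵢYᵢ` of a vector field on `ℝⁿ`. -/
noncomputable def diverg (n : ℕ)
    (Y : EuclideanSpace ℝ (Fin n) → EuclideanSpace ℝ (Fin n))
    (x : EuclideanSpace ℝ (Fin n)) : ℝ :=
  ∑ i, vpd n Y i i x

lemma contDiff_norm_rpow_mul {E : Type*} [NormedAddCommGroup E] [InnerProductSpace ℝ E]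
    {m : WithTop ℕ∞} {K : Set E} (hK : IsClosed K) (h0 : (0 : E) ∉ K) (c : ℝ) {g : E → ℝ}
    (hg : ContDiff ℝ m g) (hgK : ∀ x ∉ K, g x = 0) :
    ContDiff ℝ m fun x ↦ ‖x‖ ^ c * g x := by
  rw [contDiff_iff_contDiffAt]
  intro x
  by_cases hx : x ∈ K
  · have hx0 : x ≠ 0 := fun h ↦ h0 (h ▸ hx)
    exact ((contDiffAt_norm ℝ hx0).rpow_const_of_ne (norm_ne_zero_iff.2 hx0)).mul hg.contDiffAt
  · refine (contDiffAt_const (c := (0 : ℝ))).congr_of_eventuallyEq ?_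
    filter_upwards [hK.isOpen_compl.mem_nhds hx] with y hy
    simp [hgK y hy]

lemma integrable_norm_rpow_mul {E : Type*} [NormedAddCommGroup E] [InnerProductSpace ℝ E]
    [FiniteDimensional ℝ E] [MeasurableSpace E] [BorelSpace E] {K : Set E} (hK : IsCompact K)
    (h0 : (0 : E) ∉ K) (c : ℝ) {g : E → ℝ} (hg : Continuous g) (hgK : ∀ x ∉ K, g x = 0) :
    Integrable fun x ↦ ‖x‖ ^ c * g x :=
  (contDiff_norm_rpow_mul hK.isClosed h0 c (contDiff_zero.2 hg) hgK).continuous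
    |>.integrable_of_hasCompactSupport
      (HasCompactSupport.intro hK fun x hx ↦ by simp [hgK x hx])

section PartialDerivatives

variable {n : ℕ} {f g : EuclideanSpace ℝ (Fin n) → ℝ} {x : EuclideanSpace ℝ (Fin n)}

lemma pd_add (hf : DifferentiableAt ℝ f x) (hg : DifferentiableAt ℝ g x) (i : Fin n) :
    pd n (fun y ↦ f y + g y) i x = pd n f i x + pd n g i x := by
  simp [pd, fderiv_fun_add hf hg]

lemma pd_mul (hf : DifferentiableAt ℝ f x) (hg : DifferentiableAt ℝ g x) (i : Fin n) :
    pd n (fun y ↦ f y * g y) i x = pd n f i x * g x + f x * pd n g i x := by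
  simp [pd, fderiv_fun_mul hf hg]
  ring

lemma pd_sum {F : Fin n → EuclideanSpace ℝ (Fin n) → ℝ} (hF : ∀ j, DifferentiableAt ℝ (F j) x)
    (i : Fin n) : pd n (fun y ↦ ∑ j, F j y) i x = ∑ j, pd n (F j) i x := by
  simp [pd, fderiv_fun_sum fun j _ ↦ hF j]

lemma pd_coord (i j : Fin n) :
    pd n (fun y ↦ y j) i x = if j = i then 1 else 0 := by
  have : HasFDerivAt (fun y : EuclideanSpace ℝ (Fin n) ↦ y j)
      (EuclideanSpace.proj j : EuclideanSpace ℝ (Fin n) →L[ℝ] ℝ) x :=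
    (EuclideanSpace.proj (𝕜 := ℝ) j).hasFDerivAt
  simp [pd, this.fderiv]

lemma pd_norm_rpow (hx : x ≠ 0) (c : ℝ) (i : Fin n) :
    pd n (fun y ↦ ‖y‖ ^ c) i x = c * ‖x‖ ^ (c - 2) * x i := by
  have h : HasFDerivAt (fun y : EuclideanSpace ℝ (Fin n) ↦ ‖y‖ ^ c)
      ((c * ‖x‖ ^ (c - 2)) • innerSL ℝ x) x := by
    convert! (hasStrictFDerivAt_norm_sq x).hasFDerivAt.rpow_const (p := c / 2) (by simp [hx]) using 0
    simp_rw [← Real.rpow_natCast_mul (norm_nonneg _), ← Nat.cast_smul_eq_nsmul ℝ, smul_smul]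
    ring_nf
  simp [pd, h.fderiv, PiLp.inner_apply]

lemma sum_pd_norm_rpow_mul {G : Fin n → EuclideanSpace ℝ (Fin n) → ℝ} (hx : x ≠ 0) (c : ℝ)
    (hG : ∀ i, DifferentiableAt ℝ (G i) x) :
    ∑ i, pd n (fun y ↦ ‖y‖ ^ c * G i y) i x =
      c * ‖x‖ ^ (c - 2) * ∑ i, x i * G i x + ‖x‖ ^ c * ∑ i, pd n (G i) i x := by
  have hd : DifferentiableAt ℝ (fun y : EuclideanSpace ℝ (Fin n) ↦ ‖y‖ ^ c) x :=
    ((contDiffAt_norm (n := 1) ℝ hx).rpow_const_of_ne (norm_ne_zero_iff.2 hx)).differentiableAt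
      one_ne_zero
  simp only [pd_mul hd (hG _), pd_norm_rpow hx, Finset.sum_add_distrib, Finset.mul_sum, mul_assoc]

lemma sum_pd_mul_coord (hf : DifferentiableAt ℝ f x) :
    ∑ i, pd n (fun y ↦ f y * y i) i x = n * f x + ∑ i, x i * pd n f i x := by
  have h (i : Fin n) : DifferentiableAt ℝ (fun y : EuclideanSpace ℝ (Fin n) ↦ y i) x := by fun_prop
  simp only [pd_mul hf (h _), pd_coord, if_true, Finset.sum_add_distrib]
  simp [mul_comm, add_comm]

end PartialDerivatives

lemma integral_sum_pd_eq_zero {n : ℕ} {V : Fin n → EuclideanSpace ℝ (Fin n) → ℝ}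
    (hV : ∀ i, ContDiff ℝ 1 (V i)) (hc : ∀ i, HasCompactSupport (V i)) :
    Integrable (fun x ↦ ∑ i, pd n (V i) i x) ∧ ∫ x, ∑ i, pd n (V i) i x = 0 := by
  have hint (i : Fin n) : Integrable fun x ↦ pd n (V i) i x :=
    (((hV i).continuous_fderiv one_ne_zero).clm_apply continuous_const)
      |>.integrable_of_hasCompactSupport ((hc i).fderiv_apply ℝ _)
  refine ⟨integrable_finsetSum _ fun i _ ↦ hint i, ?_⟩
  rw [integral_finsetSum _ fun i _ ↦ hint i]
  refine Finset.sum_eq_zero fun i _ ↦ ?_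
  have h := integral_mul_fderiv_eq_neg_fderiv_mul_of_integrable (μ := volume)
    (f := fun _ : EuclideanSpace ℝ (Fin n) ↦ (1 : ℝ)) (g := V i)
    (v := EuclideanSpace.single i 1) (by simp) (by simpa [pd] using hint i)
    (by simpa using (hV i).continuous.integrable_of_hasCompactSupport (hc i))
    (by simp) (fun x _ ↦ (hV i).differentiable one_ne_zero x)
  simpa [pd] using h

section VectorFields

variable {n : ℕ} {Y : EuclideanSpace ℝ (Fin n) → EuclideanSpace ℝ (Fin n)}
  {x : EuclideanSpace ℝ (Fin n)}

lemma pd_sum_coord_mul (hY : DifferentiableAt ℝ Y x) (i : Fin n) :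
    pd n (fun y ↦ ∑ j, y j * Y y j) i x = Y x i + ∑ j, x j * vpd n Y i j x := by
  have h (j : Fin n) : DifferentiableAt ℝ (fun y : EuclideanSpace ℝ (Fin n) ↦ y j) x := by fun_prop
  have h' (j : Fin n) : DifferentiableAt ℝ (fun y ↦ Y y j) x := by fun_prop
  rw [pd_sum fun j ↦ (h j).fun_mul (h' j)]
  simp only [pd_mul (h _) (h' _), pd_coord, Finset.sum_add_distrib]
  simp [pd, vpd]

lemma pd_sum_sq (hY : DifferentiableAt ℝ Y x) (i : Fin n) :
    pd n (fun y ↦ ∑ j, Y y j * Y y j) i x = 2 * ∑ j, Y x j * vpd n Y i j x := by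
  have h' (j : Fin n) : DifferentiableAt ℝ (fun y ↦ Y y j) x := by fun_prop
  rw [pd_sum fun j ↦ (h' j).fun_mul (h' j), Finset.mul_sum]
  refine Finset.sum_congr rfl fun j _ ↦ ?_
  rw [pd_mul (h' j) (h' j)]
  simp only [pd, vpd]
  ring

lemma sum_symGrad_mul_mul (u v : Fin n → ℝ) :
    ∑ i, ∑ j, symGrad n Y i j x * (u i * v j) =
      (∑ i, ∑ j, u i * v j * vpd n Y i j x + ∑ i, ∑ j, v i * u j * vpd n Y i j x) / 2 := by
  rw [Finset.sum_comm (f := fun i j ↦ v i * u j * vpd n Y i j x), ← Finset.sum_add_distrib,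
    Finset.sum_div]
  refine Finset.sum_congr rfl fun i _ ↦ ?_
  rw [← Finset.sum_add_distrib, Finset.sum_div]
  refine Finset.sum_congr rfl fun j _ ↦ ?_
  simp only [symGrad]
  ring

/-- The divergence of `‖x‖ᶜ ⟨x, Y⟩² x`. -/
lemma sum_pd_norm_rpow_mul_inner_sq_mul (hx : x ≠ 0) (hY : DifferentiableAt ℝ Y x) (c : ℝ) :
    ∑ i, pd n (fun y ↦ ‖y‖ ^ c * ((∑ j, y j * Y y j) * (∑ j, y j * Y y j) * y i)) i x =
      ‖x‖ ^ c * ((c + n + 2) * (∑ j, x j * Y x j) ^ 2 +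
        2 * (∑ j, x j * Y x j) * ∑ i, ∑ j, symGrad n Y i j x * (x i * x j)) := by
  have hf : DifferentiableAt ℝ (fun y ↦ ∑ j, y j * Y y j) x := by fun_prop
  have hr : ‖x‖ ^ c = ‖x‖ ^ (c - 2) * ‖x‖ ^ 2 := by
    rw [← Real.rpow_natCast, ← Real.rpow_add (norm_pos_iff.2 hx)]; norm_num
  rw [sum_pd_norm_rpow_mul hx c (fun i ↦ by fun_prop), sum_pd_mul_coord (hf.fun_mul hf),
    sum_symGrad_mul_mul]
  simp only [pd_mul hf hf, pd_sum_coord_mul hY]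
  have h1 : ∑ i, x i * ((∑ j, x j * Y x j) * (∑ j, x j * Y x j) * x i) =
      (∑ j, x j * Y x j) ^ 2 * ‖x‖ ^ 2 := by
    generalize ∑ j, x j * Y x j = f
    rw [EuclideanSpace.real_norm_sq_eq, Finset.mul_sum]
    exact Finset.sum_congr rfl fun i _ ↦ by ring
  have h2 : ∑ i, x i * ((Y x i + ∑ j, x j * vpd n Y i j x) * (∑ j, x j * Y x j) +
      (∑ j, x j * Y x j) * (Y x i + ∑ j, x j * vpd n Y i j x)) =
      2 * (∑ j, x j * Y x j) *
        (∑ j, x j * Y x j + ∑ i, ∑ j, x i * x j * vpd n Y i j x) := by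
    rw [← Finset.sum_add_distrib, Finset.mul_sum]
    refine Finset.sum_congr rfl fun i _ ↦ ?_
    simp only [mul_assoc, ← Finset.mul_sum]
    ring
  rw [h1, h2, hr]
  ring

/-- The divergence of `‖x‖ᶜ (|Y|² x / 2 + ⟨x, Y⟩ Y)`. -/
lemma sum_pd_norm_rpow_mul_sq_add (hx : x ≠ 0) (hY : DifferentiableAt ℝ Y x) (c : ℝ) :
    ∑ i, pd n (fun y ↦ ‖y‖ ^ c *
        ((∑ j, Y y j * Y y j) * y i * (1 / 2) + (∑ j, y j * Y y j) * Y y i)) i x =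
      ‖x‖ ^ (c - 2) * (((c + n) / 2 + 1) * ‖x‖ ^ 2 * (∑ i, Y x i ^ 2) +
        c * (∑ j, x j * Y x j) ^ 2 +
        2 * ‖x‖ ^ 2 * (∑ i, ∑ j, symGrad n Y i j x * (x i * Y x j)) +
        ‖x‖ ^ 2 * (∑ j, x j * Y x j) * ∑ i, symGrad n Y i i x) := by
  have hf : DifferentiableAt ℝ (fun y ↦ ∑ j, y j * Y y j) x := by fun_prop
  have hq : DifferentiableAt ℝ (fun y ↦ ∑ j, Y y j * Y y j) x := by fun_prop
  have hYi (i : Fin n) : DifferentiableAt ℝ (fun y ↦ Y y i) x := by fun_prop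
  have hqi (i : Fin n) : DifferentiableAt ℝ (fun y ↦ (∑ j, Y y j * Y y j) * y i) x := by fun_prop
  have hr : ‖x‖ ^ c = ‖x‖ ^ (c - 2) * ‖x‖ ^ 2 := by
    rw [← Real.rpow_natCast, ← Real.rpow_add (norm_pos_iff.2 hx)]; norm_num
  have hpd (i : Fin n) : pd n (fun y ↦ (∑ j, Y y j * Y y j) * y i * (1 / 2) +
      (∑ j, y j * Y y j) * Y y i) i x =
      pd n (fun y ↦ (∑ j, Y y j * Y y j) * y i) i x * (1 / 2) +
      ((Y x i + ∑ j, x j * vpd n Y i j x) * Y x i + (∑ j, x j * Y x j) * symGrad n Y i i x) := by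
    rw [pd_add ((hqi i).mul_const _) (hf.fun_mul (hYi i)), pd_mul (hqi i) (differentiableAt_const _),
      pd_mul hf (hYi i), pd_sum_coord_mul hY]
    simp [pd, symGrad, vpd]
  rw [sum_pd_norm_rpow_mul hx c (fun i ↦ by fun_prop), sum_symGrad_mul_mul]
  simp only [hpd]
  rw [Finset.sum_add_distrib, ← Finset.sum_mul, sum_pd_mul_coord hq]
  simp only [pd_sum_sq hY]
  have h1 : ∑ i, x i * ((∑ j, Y x j * Y x j) * x i * (1 / 2) + (∑ j, x j * Y x j) * Y x i) =
      (∑ i, Y x i ^ 2) * ‖x‖ ^ 2 / 2 + (∑ j, x j * Y x j) ^ 2 := by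
    rw [EuclideanSpace.real_norm_sq_eq, sq (∑ j, x j * Y x j), Finset.mul_sum, Finset.mul_sum,
      Finset.sum_div, ← Finset.sum_add_distrib]
    refine Finset.sum_congr rfl fun i _ ↦ ?_
    simp only [sq (Y x _)]
    ring
  have h2 : ∑ i, x i * (2 * ∑ j, Y x j * vpd n Y i j x) =
      2 * ∑ i, ∑ j, x i * Y x j * vpd n Y i j x := by
    rw [Finset.mul_sum]
    refine Finset.sum_congr rfl fun i _ ↦ ?_
    simp only [mul_assoc, ← Finset.mul_sum]
    ring
  have h3 : ∑ i, ((Y x i + ∑ j, x j * vpd n Y i j x) * Y x i +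
      (∑ j, x j * Y x j) * symGrad n Y i i x) =
      ∑ i, Y x i ^ 2 + ∑ i, ∑ j, Y x i * x j * vpd n Y i j x +
      (∑ j, x j * Y x j) * ∑ i, symGrad n Y i i x := by
    rw [Finset.sum_add_distrib, ← Finset.mul_sum, ← Finset.sum_add_distrib]
    congr 1
    refine Finset.sum_congr rfl fun i _ ↦ ?_
    simp only [mul_assoc, ← Finset.mul_sum]
    ring
  have h4 : ∑ j, Y x j * Y x j = ∑ i, Y x i ^ 2 := by simp only [sq]
  rw [h1, h2, h3, h4, hr]
  ring

end VectorFields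

lemma sq_sum_sum_mul_mul_le {ι : Type*} [Fintype ι] (S : ι → ι → ℝ) (u v : ι → ℝ) :
    (∑ i, ∑ j, S i j * (u i * v j)) ^ 2 ≤
      (∑ i, ∑ j, S i j ^ 2) * ((∑ i, u i ^ 2) * ∑ j, v j ^ 2) := by
  have h := Finset.sum_mul_sq_le_sq_mul_sq (Finset.univ : Finset (ι × ι))
    (fun p ↦ S p.1 p.2) (fun p ↦ u p.1 * v p.2)
  simpa only [Fintype.sum_prod_type, mul_pow, Finset.sum_mul_sum] using h

lemma sq_trace_le {ι : Type*} [Fintype ι] (S : ι → ι → ℝ) :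
    (∑ i, S i i) ^ 2 ≤ Fintype.card ι * ∑ i, ∑ j, S i j ^ 2 := by
  refine sq_sum_le_card_mul_sum_sq.trans ?_
  rw [Finset.card_univ]
  gcongr with i
  exact Finset.single_le_sum (f := fun j ↦ S i j ^ 2) (fun _ _ ↦ sq_nonneg _) (Finset.mem_univ i)

/-- The pointwise inequality behind the weighted Korn inequality: `R = |x|²`, `A = |S|²`,
`B = |Y|²`, `f = ⟨x, Y⟩`, `p = S(x, x)`, `q = S(x, Y)` and `t = tr S`. -/
lemma korn_pointwise_algebra {m s b L R A B f p q t : ℝ} (hs : s ≠ 0) (hR : 0 ≤ R) (hA : 0 ≤ A)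
    (hB : 0 ≤ B) (hp : p ^ 2 ≤ A * (R * R)) (hq : q ^ 2 ≤ A * (R * B)) (ht : t ^ 2 ≤ m * A)
    (hL : L = ((s - 1) ^ 2 / 2 + |(s - 1) * b|) / s ^ 2) :
    (s - 1) ^ 2 / 2 * (R * B) ≤ (2 + m / 2 + L) * (R ^ 2 * A) -
      L * s * (-2 * s * f ^ 2 + 2 * f * p) -
      (s - 1) * ((1 - s) * R * B + b * f ^ 2 + 2 * R * q + R * f * t) := by
  have hL0 : 0 ≤ L := by rw [hL]; positivity
  have hLs : L * s ^ 2 = (s - 1) ^ 2 / 2 + |(s - 1) * b| := by rw [hL]; field_simp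
  have h1 : L * (s ^ 2 * f ^ 2) ≤ L * (R ^ 2 * A - s * (-2 * s * f ^ 2 + 2 * f * p)) :=
    mul_le_mul_of_nonneg_left (by nlinarith [sq_nonneg (s * f - p)]) hL0
  have h2 : 2 * (s - 1) * q ≤ (s - 1) ^ 2 / 2 * B + 2 * (R * A) := by
    refine le_of_sq_le_sq ?_ (by positivity)
    nlinarith [sq_nonneg ((s - 1) ^ 2 / 2 * B - 2 * (R * A)),
      mul_le_mul_of_nonneg_left hq (sq_nonneg (s - 1))]
  have h3 : (s - 1) * f * (R * t) ≤ (s - 1) ^ 2 / 2 * f ^ 2 + m / 2 * (R ^ 2 * A) := by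
    nlinarith [sq_nonneg ((s - 1) * f - R * t), mul_le_mul_of_nonneg_left ht (sq_nonneg R)]
  have h4 : (s - 1) * b * f ^ 2 ≤ |(s - 1) * b| * f ^ 2 :=
    mul_le_mul_of_nonneg_right (le_abs_self _) (sq_nonneg f)
  have h5 : L * (s ^ 2 * f ^ 2) = (s - 1) ^ 2 / 2 * f ^ 2 + |(s - 1) * b| * f ^ 2 := by
    rw [← mul_assoc, hLs]; ring
  linarith [mul_le_mul_of_nonneg_left h2 hR]

/-- Flat-case weighted Korn-type inequality in the asymptotically flat setting:
for `s ∉ {0,1}` there is `C > 0` with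
`∫ r^{−2s−n+2}|S(Y)|² ≥ C ∫ r^{−2s−n}|Y|²`
for all `C¹` vector fields `Y` compactly supported away from the origin. -/
theorem weighted_korn_radial (n : ℕ) (hn : 2 ≤ n) (s : ℝ) (hs0 : s ≠ 0) (hs1 : s ≠ 1) :
    ∃ C > (0:ℝ),
      ∀ Y : EuclideanSpace ℝ (Fin n) → EuclideanSpace ℝ (Fin n),
        ContDiff ℝ 1 Y → HasCompactSupport Y →
        tsupport Y ⊆ {x : EuclideanSpace ℝ (Fin n) | x ≠ 0} →
        ∫ x : EuclideanSpace ℝ (Fin n),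
            ‖x‖ ^ (-2 * s - (n : ℝ) + 2) * ∑ i, ∑ j, (symGrad n Y i j x) ^ 2
          ≥ C * ∫ x : EuclideanSpace ℝ (Fin n),
              ‖x‖ ^ (-2 * s - (n : ℝ)) * ∑ i, (Y x i) ^ 2 := by
  set b : ℝ := -2 * s - n with hb
  set L : ℝ := ((s - 1) ^ 2 / 2 + |(s - 1) * b|) / s ^ 2 with hL
  have hL0 : 0 ≤ L := by positivity
  have hσ : 0 < (s - 1) ^ 2 / 2 := by have := sub_ne_zero.2 hs1; positivity
  have hM : 0 < 2 + (n : ℝ) / 2 + L := by positivity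
  refine ⟨(s - 1) ^ 2 / 2 / (2 + n / 2 + L), by positivity, fun Y hY hc hsupp ↦ ?_⟩
  have hK : IsCompact (tsupport Y) := hc
  have h0 : (0 : EuclideanSpace ℝ (Fin n)) ∉ tsupport Y := fun h ↦ hsupp h rfl
  have hYd : Differentiable ℝ Y := hY.differentiable one_ne_zero
  have hY0 : ∀ x ∉ tsupport Y, Y x = 0 := fun x hx ↦ image_eq_zero_of_notMem_tsupport hx
  have hS0 : ∀ x ∉ tsupport Y, ∀ i j, symGrad n Y i j x = 0 := by
    intro x hx i j
    have h (k : Fin n) : fderiv ℝ (fun y ↦ Y y k) x = 0 :=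
      fderiv_of_notMem_tsupport ℝ fun h ↦ hx
        (tsupport_comp_subset (g := fun v : EuclideanSpace ℝ (Fin n) ↦ v k) rfl Y h)
    simp [symGrad, vpd, h]
  have hYi (i : Fin n) : ContDiff ℝ 1 fun y ↦ Y y i := contDiff_euclidean.1 hY i
  have hvpd (i j : Fin n) : Continuous (vpd n Y i j) :=
    ((hYi j).continuous_fderiv one_ne_zero).clm_apply continuous_const
  have hSc (i j : Fin n) : Continuous (symGrad n Y i j) :=
    ((hvpd i j).add (hvpd j i)).div_const 2
  have hIS := integrable_norm_rpow_mul hK h0 (b + 2)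
    (g := fun x ↦ ∑ i, ∑ j, symGrad n Y i j x ^ 2) (by fun_prop) fun x hx ↦ by simp [hS0 x hx]
  have hIY := integrable_norm_rpow_mul hK h0 b
    (g := fun x ↦ ∑ i, Y x i ^ 2) (by fun_prop) fun x hx ↦ by simp [hY0 x hx]
  have hx (i : Fin n) : ContDiff ℝ 1 fun y : EuclideanSpace ℝ (Fin n) ↦ y i :=
    contDiff_euclidean.1 contDiff_id i
  let G (i : Fin n) (y : EuclideanSpace ℝ (Fin n)) : ℝ :=
    (∑ j, y j * Y y j) * (∑ j, y j * Y y j) * y i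
  let H (i : Fin n) (y : EuclideanSpace ℝ (Fin n)) : ℝ :=
    (∑ j, Y y j * Y y j) * y i * (1 / 2) + (∑ j, y j * Y y j) * Y y i
  have hG0 (i : Fin n) : ∀ x ∉ tsupport Y, G i x = 0 := fun x hx ↦ by simp [G, hY0 x hx]
  have hH0 (i : Fin n) : ∀ x ∉ tsupport Y, H i x = 0 := fun x hx ↦ by simp [H, hY0 x hx]
  obtain ⟨hIG, hG⟩ := integral_sum_pd_eq_zero (V := fun i y ↦ ‖y‖ ^ (b - 2) * G i y)
    (fun i ↦ contDiff_norm_rpow_mul hK.isClosed h0 _ (by fun_prop) (hG0 i))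
    (fun i ↦ HasCompactSupport.intro hK fun x hx ↦ by simp [hG0 i x hx])
  obtain ⟨hIH, hH⟩ := integral_sum_pd_eq_zero (V := fun i y ↦ ‖y‖ ^ b * H i y)
    (fun i ↦ contDiff_norm_rpow_mul hK.isClosed h0 _ (by fun_prop) (hH0 i))
    (fun i ↦ HasCompactSupport.intro hK fun x hx ↦ by simp [hH0 i x hx])
  have key : ∀ x, (s - 1) ^ 2 / 2 * (‖x‖ ^ b * ∑ i, Y x i ^ 2) ≤
      (2 + n / 2 + L) * (‖x‖ ^ (b + 2) * ∑ i, ∑ j, symGrad n Y i j x ^ 2) -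
      L * s * ∑ i, pd n (fun y ↦ ‖y‖ ^ (b - 2) * G i y) i x -
      (s - 1) * ∑ i, pd n (fun y ↦ ‖y‖ ^ b * H i y) i x := by
    intro x
    by_cases hxK : x ∈ tsupport Y
    · have hx0 : x ≠ 0 := hsupp hxK
      have hrb : ‖x‖ ^ b = ‖x‖ ^ (b - 2) * ‖x‖ ^ 2 := by
        rw [← Real.rpow_natCast, ← Real.rpow_add (norm_pos_iff.2 hx0)]; norm_num
      have hrb2 : ‖x‖ ^ (b + 2) = ‖x‖ ^ (b - 2) * (‖x‖ ^ 2) ^ 2 := by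
        rw [← pow_mul, ← Real.rpow_natCast, ← Real.rpow_add (norm_pos_iff.2 hx0)]
        congr 1; norm_num; ring
      rw [sum_pd_norm_rpow_mul_inner_sq_mul hx0 (hYd x), sum_pd_norm_rpow_mul_sq_add hx0 (hYd x),
        hrb, hrb2]
      have hn2 : b - 2 + n + 2 = -2 * s := by rw [hb]; ring
      have hn1 : (b + n) / 2 + 1 = 1 - s := by rw [hb]; ring
      rw [hn2, hn1]
      have hp := sq_sum_sum_mul_mul_le (fun i j ↦ symGrad n Y i j x) (fun i ↦ x i) fun i ↦ x i
      have hq := sq_sum_sum_mul_mul_le (fun i j ↦ symGrad n Y i j x) (fun i ↦ x i) fun i ↦ Y x i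
      have ht := sq_trace_le fun i j ↦ symGrad n Y i j x
      rw [← EuclideanSpace.real_norm_sq_eq] at hp hq
      rw [Fintype.card_fin] at ht
      have := mul_le_mul_of_nonneg_left (korn_pointwise_algebra (f := ∑ j, x j * Y x j) hs0
        (sq_nonneg ‖x‖) (by positivity) (by positivity) hp hq ht hL)
        (Real.rpow_nonneg (norm_nonneg x) (b - 2))
      linarith
    · have hz (g : EuclideanSpace ℝ (Fin n) → ℝ) (hg : ∀ y ∉ tsupport Y, g y = 0) (c : ℝ)
          (i : Fin n) : pd n (fun y ↦ ‖y‖ ^ c * g y) i x = 0 := by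
        have : (fun y ↦ ‖y‖ ^ c * g y) =ᶠ[nhds x] fun _ ↦ 0 := by
          filter_upwards [hK.isClosed.isOpen_compl.mem_nhds hxK] with y hy
          simp [hg y hy]
        simp [pd, this.fderiv_eq]
      simp [hz _ (hG0 _), hz _ (hH0 _), hY0 x hxK, hS0 x hxK]
  have hint := integral_mono (hIY.const_mul ((s - 1) ^ 2 / 2))
    (((hIS.const_mul (2 + n / 2 + L)).sub (hIG.const_mul (L * s))).sub (hIH.const_mul (s - 1))) key
  rw [integral_sub' ((hIS.const_mul _).sub (hIG.const_mul _)) (hIH.const_mul _),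
    integral_sub' (hIS.const_mul _) (hIG.const_mul _), integral_const_mul, integral_const_mul,
    integral_const_mul, integral_const_mul, hG, hH, mul_zero, mul_zero, sub_zero, sub_zero] at hint
  rw [ge_iff_le, div_mul_eq_mul_div, div_le_iff₀ hM]
  linarith
end

section
/- Let n ≥ 1 and let s ∈ ℝ with s ≠ −1/2. Then there exists a constant C > 0 such that for every C¹ vector field Y on ℝⁿ with compact support contained in the open half-space {x ∈ ℝⁿ : xₙ > 0}, one has ∫ xₙ^{2s} |Y|² dx ≤ C ∫ xₙ^{2s+2} |S(Y)|² dx. -/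
open MeasureTheory Real

/-- A power of a coordinate times a function supported where that coordinate is positive
inherits the regularity of the function. -/
lemma contDiff_coord_rpow_mul {n : ℕ} {m : WithTop ℕ∞} (N : Fin n) (p : ℝ)
    {f : EuclideanSpace ℝ (Fin n) → ℝ} (hf : ContDiff ℝ m f)
    (hs : tsupport f ⊆ {x | 0 < x N}) :
    ContDiff ℝ m (fun x => x N ^ p * f x) := by
  rw [contDiff_iff_contDiffAt]
  intro x
  by_cases hx : x ∈ tsupport f
  · have h1 : ContDiffAt ℝ m (fun x : EuclideanSpace ℝ (Fin n) => x N) x := by fun_prop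
    exact (h1.rpow_const_of_ne (hs hx).ne').mul hf.contDiffAt
  · refine (contDiffAt_const (c := (0 : ℝ))).congr_of_eventuallyEq ?_
    filter_upwards [notMem_tsupport_iff_eventuallyEq.mp hx] with y hy
    simp [hy]

lemma integrable_coord_rpow_mul {n : ℕ} (N : Fin n) (p : ℝ)
    {f : EuclideanSpace ℝ (Fin n) → ℝ} (hf : Continuous f) (hc : HasCompactSupport f)
    (hs : tsupport f ⊆ {x | 0 < x N}) :
    Integrable (fun x => x N ^ p * f x) :=
  (contDiff_coord_rpow_mul N p (contDiff_zero.mpr hf) hs).continuous.integrable_of_hasCompactSupport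
    hc.mul_left

lemma continuous_pd {n : ℕ} {f : EuclideanSpace ℝ (Fin n) → ℝ} (hf : ContDiff ℝ 1 f)
    (i : Fin n) : Continuous (pd n f i) :=
  (hf.continuous_fderiv one_ne_zero).clm_apply continuous_const

lemma pd_eq_zero_of_notMem_tsupport {n : ℕ} {f : EuclideanSpace ℝ (Fin n) → ℝ} (i : Fin n)
    {x : EuclideanSpace ℝ (Fin n)} (hx : x ∉ tsupport f) : pd n f i x = 0 := by
  simp [pd, fderiv_of_notMem_tsupport ℝ hx]

lemma integrable_pd {n : ℕ} {f : EuclideanSpace ℝ (Fin n) → ℝ} (hf : ContDiff ℝ 1 f)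
    (hc : HasCompactSupport f) (i : Fin n) : Integrable (pd n f i) :=
  (continuous_pd hf i).integrable_of_hasCompactSupport (hc.fderiv_apply ℝ _)

lemma integral_pd_eq_zero {n : ℕ} {f : EuclideanSpace ℝ (Fin n) → ℝ} (hf : ContDiff ℝ 1 f)
    (hc : HasCompactSupport f) (i : Fin n) : ∫ x, pd n f i x = 0 := by
  have h := integral_mul_fderiv_eq_neg_fderiv_mul_of_integrable (𝕜 := ℝ)
    (μ := (volume : Measure (EuclideanSpace ℝ (Fin n))))
    (f := fun _ : EuclideanSpace ℝ (Fin n) => (1 : ℝ)) (g := f)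
    (v := EuclideanSpace.single i 1) (by simp)
    (by simp only [one_mul]; exact integrable_pd hf hc i)
    (by simpa using hf.continuous.integrable_of_hasCompactSupport hc)
    (by fun_prop) (fun x _ => hf.differentiable one_ne_zero x)
  simpa [pd] using h

/-- Product rule for a power of a coordinate times a product. -/
lemma pd_coord_rpow_mul_mul {n : ℕ} (N : Fin n) (p : ℝ)
    {u v : EuclideanSpace ℝ (Fin n) → ℝ} (i : Fin n) {x : EuclideanSpace ℝ (Fin n)}
    (hx : 0 < x N) (hu : DifferentiableAt ℝ u x) (hv : DifferentiableAt ℝ v x) :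
    pd n (fun x => x N ^ p * (u x * v x)) i x =
      (if i = N then p * x N ^ (p - 1) else 0) * (u x * v x) +
        x N ^ p * (pd n u i x * v x + u x * pd n v i x) := by
  have h1 : HasFDerivAt (fun x : EuclideanSpace ℝ (Fin n) => x N)
      (EuclideanSpace.proj N : EuclideanSpace ℝ (Fin n) →L[ℝ] ℝ) x :=
    (EuclideanSpace.proj N : EuclideanSpace ℝ (Fin n) →L[ℝ] ℝ).hasFDerivAt
  have h2 := (h1.rpow_const (p := p) (Or.inl hx.ne')).mul (hu.hasFDerivAt.mul hv.hasFDerivAt)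
  have h3 : pd n (fun x => x N ^ p * (u x * v x)) i x = _ :=
    congrArg (fun L => L (EuclideanSpace.single i (1 : ℝ))) h2.fderiv
  rw [h3]
  by_cases h : i = N
  · subst h
    simp [pd]
    ring
  · simp [pd, h, Ne.symm h]
    ring

lemma mul_sq_le_of_hardy_identity {k t w y S D : ℝ} (hk : k ≠ 0) (hw : 0 < w)
    (hD : D = k * w * y ^ 2 + 2 * (t * w) * (y * S)) :
    w * y ^ 2 ≤ 2 / k * D + 4 / k ^ 2 * (t ^ 2 * w * S ^ 2) := by
  have h : 2 / k * D + 4 / k ^ 2 * (t ^ 2 * w * S ^ 2) - w * y ^ 2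
      = w * (y + 2 / k * (t * S)) ^ 2 := by
    subst hD
    field_simp
    ring
  have : 0 ≤ w * (y + 2 / k * (t * S)) ^ 2 := by positivity
  linarith

lemma mul_sq_le_of_korn_identity {k t w y z S T D : ℝ} (hk : k ≠ 0) (hw : 0 < w)
    (hD : D = k * w * y ^ 2 + 4 * (t * w) * (y * S) + 2 * (t * w) * (T * z)) :
    w * y ^ 2 ≤ 2 / k * D + 16 / k ^ 2 * (t ^ 2 * w * S ^ 2) + 2 * (w * z ^ 2)
      + 2 / k ^ 2 * (t ^ 2 * w * T ^ 2) := by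
  have h : 2 / k * D + 16 / k ^ 2 * (t ^ 2 * w * S ^ 2) + 2 * (w * z ^ 2)
      + 2 / k ^ 2 * (t ^ 2 * w * T ^ 2) - w * y ^ 2
      = w * (y + 4 / k * (t * S)) ^ 2 + w * (z + 1 / k * (t * T)) ^ 2
        + w * (z + 1 / k * (t * T)) ^ 2 := by
    subst hD
    field_simp
    ring
  have : 0 ≤ w * (y + 4 / k * (t * S)) ^ 2 + w * (z + 1 / k * (t * T)) ^ 2
        + w * (z + 1 / k * (t * T)) ^ 2 := by positivity
  linarith

/-- The squared norm of the symmetrized gradient, `|S(Y)|²`. -/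
noncomputable def symGradSq (n : ℕ) (Y : EuclideanSpace ℝ (Fin n) → EuclideanSpace ℝ (Fin n))
    (x : EuclideanSpace ℝ (Fin n)) : ℝ :=
  ∑ i, ∑ j, (symGrad n Y i j x) ^ 2

lemma sq_symGrad_le (n : ℕ) (Y : EuclideanSpace ℝ (Fin n) → EuclideanSpace ℝ (Fin n))
    (x : EuclideanSpace ℝ (Fin n)) (i j : Fin n) :
    symGrad n Y i j x ^ 2 ≤ symGradSq n Y x :=
  (Finset.single_le_sum (f := fun j => symGrad n Y i j x ^ 2) (fun _ _ => sq_nonneg _)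
    (Finset.mem_univ j)).trans
    (Finset.single_le_sum (f := fun i => ∑ j, symGrad n Y i j x ^ 2)
      (fun _ _ => Finset.sum_nonneg fun _ _ => sq_nonneg _) (Finset.mem_univ i))

lemma continuous_symGradSq {n : ℕ} {Y : EuclideanSpace ℝ (Fin n) → EuclideanSpace ℝ (Fin n)}
    (hY : ContDiff ℝ 1 Y) : Continuous (symGradSq n Y) := by
  have h (i j : Fin n) : Continuous (vpd n Y i j) :=
    continuous_pd (f := fun x => Y x j) (by fun_prop) i
  unfold symGradSq symGrad
  fun_prop

lemma tsupport_subset_of_forall_eq_zero {X E F : Type*} [TopologicalSpace X] [Zero E] [Zero F]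
    {Y : X → E} {f : X → F} (h : ∀ x, x ∉ tsupport Y → f x = 0) : tsupport f ⊆ tsupport Y :=
  closure_minimal (fun x hx => by_contra fun hn => hx (h x hn)) (isClosed_tsupport Y)

section Field

variable {n : ℕ} {Y : EuclideanSpace ℝ (Fin n) → EuclideanSpace ℝ (Fin n)}

lemma tsupport_coord_subset (a : Fin n) : tsupport (fun x => Y x a) ⊆ tsupport Y :=
  tsupport_subset_of_forall_eq_zero fun x hx => by simp [image_eq_zero_of_notMem_tsupport hx]

lemma tsupport_coord_mul_coord_subset (a b : Fin n) :
    tsupport (fun x => Y x a * Y x b) ⊆ tsupport Y :=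
  tsupport_subset_of_forall_eq_zero fun x hx => by simp [image_eq_zero_of_notMem_tsupport hx]

lemma symGradSq_eq_zero_of_notMem_tsupport {x : EuclideanSpace ℝ (Fin n)}
    (hx : x ∉ tsupport Y) : symGradSq n Y x = 0 := by
  have h (i j : Fin n) : vpd n Y i j x = 0 :=
    pd_eq_zero_of_notMem_tsupport i fun h => hx (tsupport_coord_subset j h)
  simp [symGradSq, symGrad, h]

/-- The weighted product `x_N ^ p * Y_a * Y_b`. -/
noncomputable def weightedProd (Y : EuclideanSpace ℝ (Fin n) → EuclideanSpace ℝ (Fin n))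
    (N : Fin n) (p : ℝ) (a b : Fin n) (x : EuclideanSpace ℝ (Fin n)) : ℝ :=
  x N ^ p * (Y x a * Y x b)

lemma contDiff_weightedProd (hY : ContDiff ℝ 1 Y) {N : Fin n}
    (hs : tsupport Y ⊆ {x | 0 < x N}) (p : ℝ) (a b : Fin n) :
    ContDiff ℝ 1 (weightedProd Y N p a b) :=
  contDiff_coord_rpow_mul N p (f := fun x => Y x a * Y x b) (by fun_prop)
    ((tsupport_coord_mul_coord_subset a b).trans hs)

lemma tsupport_weightedProd_subset (N : Fin n) (p : ℝ) (a b : Fin n) :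
    tsupport (weightedProd Y N p a b) ⊆ tsupport Y :=
  tsupport_subset_of_forall_eq_zero fun x hx => by
    simp [weightedProd, image_eq_zero_of_notMem_tsupport hx]

lemma hasCompactSupport_weightedProd (hc : HasCompactSupport Y) (N : Fin n) (p : ℝ)
    (a b : Fin n) : HasCompactSupport (weightedProd Y N p a b) :=
  hc.of_isClosed_subset (isClosed_tsupport _) (tsupport_weightedProd_subset N p a b)

lemma symGrad_self (N : Fin n) (x : EuclideanSpace ℝ (Fin n)) :
    symGrad n Y N N x = pd n (fun x => Y x N) N x := by
  simp only [symGrad, vpd, pd]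
  ring

lemma weighted_sq_normal_le (hY : ContDiff ℝ 1 Y) {N : Fin n} (hs : tsupport Y ⊆ {x | 0 < x N})
    {s : ℝ} (hk : 2 * s + 1 ≠ 0) (x : EuclideanSpace ℝ (Fin n)) :
    x N ^ (2 * s) * (Y x N) ^ 2 ≤
      2 / (2 * s + 1) * pd n (weightedProd Y N (2 * s + 1) N N) N x +
        4 / (2 * s + 1) ^ 2 * (x N ^ (2 * s + 2) * symGradSq n Y x) := by
  by_cases hx : x ∈ tsupport Y
  · have ht : 0 < x N := hs hx
    have hd (j : Fin n) : DifferentiableAt ℝ (fun x => Y x j) x := by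
      have : ContDiff ℝ 1 (fun x => Y x j) := by fun_prop
      exact this.differentiable one_ne_zero x
    have hw : 0 < x N ^ (2 * s) := rpow_pos_of_pos ht _
    have h := mul_sq_le_of_hardy_identity (t := x N) (w := x N ^ (2 * s)) (y := Y x N)
      (S := symGrad n Y N N x) (D := pd n (weightedProd Y N (2 * s + 1) N N) N x) hk hw (by
        unfold weightedProd
        rw [pd_coord_rpow_mul_mul N _ N ht (hd N) (hd N), symGrad_self]
        simp only [if_true, add_sub_cancel_right, rpow_add_one ht.ne']
        ring)
    have hp : x N ^ (2 * s + 2) = x N ^ 2 * x N ^ (2 * s) := by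
      rw [rpow_add ht, rpow_two, mul_comm]
    rw [hp]
    have hE := sq_symGrad_le n Y x N N
    refine h.trans ?_
    gcongr
  · rw [pd_eq_zero_of_notMem_tsupport N fun h => hx (tsupport_weightedProd_subset _ _ _ _ h),
      symGradSq_eq_zero_of_notMem_tsupport hx, image_eq_zero_of_notMem_tsupport hx]
    simp

lemma weighted_sq_tangential_le (hY : ContDiff ℝ 1 Y) {N : Fin n}
    (hs : tsupport Y ⊆ {x | 0 < x N}) {s : ℝ} (hk : 2 * s + 1 ≠ 0) {a : Fin n} (ha : a ≠ N)
    (x : EuclideanSpace ℝ (Fin n)) :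
    x N ^ (2 * s) * (Y x a) ^ 2 ≤
      2 / (2 * s + 1) * (pd n (weightedProd Y N (2 * s + 1) a a) N x +
          2 * pd n (weightedProd Y N (2 * s + 1) a N) a x) +
        18 / (2 * s + 1) ^ 2 * (x N ^ (2 * s + 2) * symGradSq n Y x) +
        2 * (x N ^ (2 * s) * (Y x N) ^ 2) := by
  by_cases hx : x ∈ tsupport Y
  · have ht : 0 < x N := hs hx
    have hd (j : Fin n) : DifferentiableAt ℝ (fun x => Y x j) x := by
      have : ContDiff ℝ 1 (fun x => Y x j) := by fun_prop
      exact this.differentiable one_ne_zero x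
    have hw : 0 < x N ^ (2 * s) := rpow_pos_of_pos ht _
    have h := mul_sq_le_of_korn_identity (t := x N) (w := x N ^ (2 * s)) (y := Y x a)
      (z := Y x N) (S := symGrad n Y N a x) (T := symGrad n Y a a x)
      (D := pd n (weightedProd Y N (2 * s + 1) a a) N x +
        2 * pd n (weightedProd Y N (2 * s + 1) a N) a x) hk hw (by
        unfold weightedProd
        rw [pd_coord_rpow_mul_mul N _ N ht (hd a) (hd a),
          pd_coord_rpow_mul_mul N _ a ht (hd a) (hd N), symGrad_self]
        simp only [if_true, if_neg ha, add_sub_cancel_right, rpow_add_one ht.ne', symGrad, vpd, pd]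
        ring)
    have hp : x N ^ (2 * s + 2) = x N ^ 2 * x N ^ (2 * s) := by
      rw [rpow_add ht, rpow_two, mul_comm]
    rw [hp]
    have h1 : 16 / (2 * s + 1) ^ 2 * (x N ^ 2 * x N ^ (2 * s) * symGrad n Y N a x ^ 2) ≤
        16 / (2 * s + 1) ^ 2 * (x N ^ 2 * x N ^ (2 * s) * symGradSq n Y x) := by
      have := sq_symGrad_le n Y x N a
      gcongr
    have h2 : 2 / (2 * s + 1) ^ 2 * (x N ^ 2 * x N ^ (2 * s) * symGrad n Y a a x ^ 2) ≤
        2 / (2 * s + 1) ^ 2 * (x N ^ 2 * x N ^ (2 * s) * symGradSq n Y x) := by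
      have := sq_symGrad_le n Y x a a
      gcongr
    have h3 (e : ℝ) : 18 / (2 * s + 1) ^ 2 * e =
        16 / (2 * s + 1) ^ 2 * e + 2 / (2 * s + 1) ^ 2 * e := by ring
    rw [h3]
    linarith
  · rw [pd_eq_zero_of_notMem_tsupport N fun h => hx (tsupport_weightedProd_subset _ _ _ _ h),
      pd_eq_zero_of_notMem_tsupport a fun h => hx (tsupport_weightedProd_subset _ _ _ _ h),
      symGradSq_eq_zero_of_notMem_tsupport hx, image_eq_zero_of_notMem_tsupport hx]
    simp

lemma integrable_weighted_sq (hY : ContDiff ℝ 1 Y) (hc : HasCompactSupport Y) {N : Fin n}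
    (hs : tsupport Y ⊆ {x | 0 < x N}) (p : ℝ) (a : Fin n) :
    Integrable (fun x => x N ^ p * (Y x a) ^ 2) := by
  simp only [sq]
  exact (contDiff_weightedProd hY hs p a a).continuous.integrable_of_hasCompactSupport
    (hasCompactSupport_weightedProd hc N p a a)

lemma integrable_weighted_symGradSq (hY : ContDiff ℝ 1 Y) (hc : HasCompactSupport Y) {N : Fin n}
    (hs : tsupport Y ⊆ {x | 0 < x N}) (p : ℝ) :
    Integrable (fun x => x N ^ p * symGradSq n Y x) := by
  have h : tsupport (symGradSq n Y) ⊆ tsupport Y :=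
    tsupport_subset_of_forall_eq_zero fun _ => symGradSq_eq_zero_of_notMem_tsupport
  exact integrable_coord_rpow_mul N p (continuous_symGradSq hY)
    (hc.of_isClosed_subset (isClosed_tsupport _) h) (h.trans hs)

lemma integral_weighted_sq_normal_le (hY : ContDiff ℝ 1 Y) (hc : HasCompactSupport Y) {N : Fin n}
    (hs : tsupport Y ⊆ {x | 0 < x N}) {s : ℝ} (hk : 2 * s + 1 ≠ 0) :
    ∫ x, x N ^ (2 * s) * (Y x N) ^ 2 ≤
      4 / (2 * s + 1) ^ 2 * ∫ x, x N ^ (2 * s + 2) * symGradSq n Y x := by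
  have hG := contDiff_weightedProd hY hs (2 * s + 1) N N
  have hGc := hasCompactSupport_weightedProd hc N (2 * s + 1) N N
  have hi := (integrable_pd hG hGc N).const_mul (2 / (2 * s + 1))
  have hE := (integrable_weighted_symGradSq hY hc hs (2 * s + 2)).const_mul (4 / (2 * s + 1) ^ 2)
  refine (integral_mono (integrable_weighted_sq hY hc hs _ N) (hi.add hE)
    (weighted_sq_normal_le hY hs hk)).trans_eq ?_
  simp only [Pi.add_apply]
  rw [integral_add hi hE, integral_const_mul, integral_const_mul, integral_pd_eq_zero hG hGc]
  ring

lemma integral_weighted_sq_tangential_le (hY : ContDiff ℝ 1 Y) (hc : HasCompactSupport Y)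
    {N : Fin n} (hs : tsupport Y ⊆ {x | 0 < x N}) {s : ℝ} (hk : 2 * s + 1 ≠ 0) {a : Fin n}
    (ha : a ≠ N) :
    ∫ x, x N ^ (2 * s) * (Y x a) ^ 2 ≤
      18 / (2 * s + 1) ^ 2 * (∫ x, x N ^ (2 * s + 2) * symGradSq n Y x) +
        2 * ∫ x, x N ^ (2 * s) * (Y x N) ^ 2 := by
  have hG (b : Fin n) := contDiff_weightedProd hY hs (2 * s + 1) a b
  have hGc (b : Fin n) := hasCompactSupport_weightedProd hc N (2 * s + 1) a b
  have hi₁ := integrable_pd (hG a) (hGc a) N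
  have hi₂ := (integrable_pd (hG N) (hGc N) a).const_mul 2
  have hi := (hi₁.add hi₂).const_mul (2 / (2 * s + 1))
  have hE := (integrable_weighted_symGradSq hY hc hs (2 * s + 2)).const_mul (18 / (2 * s + 1) ^ 2)
  have hN := (integrable_weighted_sq hY hc hs (2 * s) N).const_mul 2
  refine (integral_mono (integrable_weighted_sq hY hc hs _ a) ((hi.add hE).add hN)
    (weighted_sq_tangential_le hY hs hk ha)).trans_eq ?_
  rw [integral_add' (hi.add hE) hN, integral_add' hi hE, integral_const_mul, integral_const_mul,
    integral_const_mul, integral_add' hi₁ hi₂, integral_const_mul,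
    integral_pd_eq_zero (hG a) (hGc a), integral_pd_eq_zero (hG N) (hGc N)]
  ring

lemma integral_weighted_sq_le (hY : ContDiff ℝ 1 Y) (hc : HasCompactSupport Y)
    {N : Fin n} (hs : tsupport Y ⊆ {x | 0 < x N}) {s : ℝ} (hk : 2 * s + 1 ≠ 0) (a : Fin n) :
    ∫ x, x N ^ (2 * s) * (Y x a) ^ 2 ≤
      26 / (2 * s + 1) ^ 2 * ∫ x, x N ^ (2 * s + 2) * symGradSq n Y x := by
  have hN := integral_weighted_sq_normal_le hY hc hs hk
  have h₀ : 0 ≤ ∫ x, x N ^ (2 * s) * (Y x N) ^ 2 := integral_nonneg fun x => by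
    by_cases hx : x ∈ tsupport Y
    · have : 0 < x N := hs hx
      positivity
    · simp [image_eq_zero_of_notMem_tsupport hx]
  set I := ∫ x, x N ^ (2 * s + 2) * symGradSq n Y x
  have e : 26 / (2 * s + 1) ^ 2 * I =
      18 / (2 * s + 1) ^ 2 * I + 2 * (4 / (2 * s + 1) ^ 2 * I) := by ring
  have e' : 18 / (2 * s + 1) ^ 2 * I = 9 / 2 * (4 / (2 * s + 1) ^ 2 * I) := by ring
  rcases eq_or_ne a N with rfl | ha
  · linarith
  · linarith [integral_weighted_sq_tangential_le hY hc hs hk ha]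

end Field

/-- Flat-case weighted Korn-type inequality near a boundary: for `s ≠ −1/2`
there is `C > 0` with `∫ xₙ^{2s}|Y|² ≤ C ∫ xₙ^{2s+2}|S(Y)|²`
for all `C¹` vector fields `Y` compactly supported in `{xₙ > 0}`. -/
theorem weighted_korn_halfspace (n : ℕ) (hn : 1 ≤ n) (s : ℝ) (hs : s ≠ -(1/2)) :
    ∃ C > (0:ℝ),
      ∀ Y : EuclideanSpace ℝ (Fin n) → EuclideanSpace ℝ (Fin n),
        ContDiff ℝ 1 Y → HasCompactSupport Y →
        tsupport Y ⊆ {x : EuclideanSpace ℝ (Fin n) | 0 < x ⟨n - 1, by omega⟩} →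
        ∫ x : EuclideanSpace ℝ (Fin n),
            (x (⟨n - 1, by omega⟩ : Fin n)) ^ (2 * s) * ∑ i, (Y x i) ^ 2
          ≤ C * ∫ x : EuclideanSpace ℝ (Fin n),
              (x (⟨n - 1, by omega⟩ : Fin n)) ^ (2 * s + 2) *
                ∑ i, ∑ j, (symGrad n Y i j x) ^ 2 := by
  have hk : 2 * s + 1 ≠ 0 := fun h => hs (by linarith)
  refine ⟨n * (26 / (2 * s + 1) ^ 2), by positivity, fun Y hY hc hsupp => ?_⟩
  simp only [Finset.mul_sum (Finset.univ : Finset (Fin n)) (fun i => (Y _ i) ^ 2)]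
  rw [integral_finsetSum _ fun a _ => integrable_weighted_sq hY hc hsupp _ a]
  refine (Finset.sum_le_sum fun a _ => integral_weighted_sq_le hY hc hsupp hk a).trans_eq ?_
  simp only [Finset.sum_const, Finset.card_univ, Fintype.card_fin, nsmul_eq_mul, symGradSq]
  ring
end
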